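/- Let f : ℝ^p → ℝ be differentiable, L-smooth and m-strongly convex with 0 < m ≤ L, let x⋆ be the unique point with ∇f(x⋆) = 0, let α, β, η ∈ ℝ with δ = β − η, and let 0 ≤ ρ ≤ 1. Given x_k, x_{k−1} ∈ ℝ^p, set y_k = (1+η)x_k − ηx_{k−1}, x_{k+1} = (1+β)x_k − βx_{k−1} − α∇f(y_k), and d = x_k − x_{k−1}. Define Q₁ := (1/2)·( −Lδ²‖d‖² − 2(1 − Lα)δ⟨∇f(y_k), d⟩ + α(2 − Lα)‖∇f(y_k)‖² ), Q₂ := (1/2)·( mη²‖d‖² − 2η⟨∇f(y_k), d⟩ ), and Q₃ := (1/2)·( m‖y_k − x⋆‖² − 2⟨∇f(y_k), y_k − x⋆⟩ ). Then Q₁ + ρ²Q₂ + (1 − ρ²)Q₃ ≤ ρ²(f(x_k) − f(x⋆)) − (f(x_{k+1}) − f(x⋆)). -/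

import Mathlib

open RealInnerProductSpace

/-- The quadratic upper bound (descent lemma) for a function with `L`-Lipschitz gradient. -/
theorem le_add_inner_gradient_add_sq {E : Type*} [NormedAddCommGroup E] [InnerProductSpace ℝ E]
    [CompleteSpace E] {f : E → ℝ} {L : ℝ} (hf : Differentiable ℝ f)
    (hsmooth : ∀ x y, ‖gradient f x - gradient f y‖ ≤ L * ‖x - y‖) (y v : E) :
    f (y + v) ≤ f y + ⟪gradient f y, v⟫ + L / 2 * ‖v‖ ^ 2 := by
  let φ : ℝ → ℝ := fun t ↦ f (y + t • v) - t * ⟪gradient f y, v⟫ - t ^ 2 * (L / 2 * ‖v‖ ^ 2)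
  have hφ (t : ℝ) : HasDerivAt φ
      (⟪gradient f (y + t • v) - gradient f y, v⟫ - t * (L * ‖v‖ ^ 2)) t := by
    have hline : HasDerivAt (fun t : ℝ ↦ y + t • v) v t := by
      simpa using ((hasDerivAt_id t).smul_const v).const_add y
    have hcomp := (hf (y + t • v)).hasGradientAt.hasFDerivAt.comp_hasDerivAt t hline
    have h := (hcomp.sub ((hasDerivAt_id t).mul_const ⟪gradient f y, v⟫)).sub
      ((hasDerivAt_pow 2 t).mul_const (L / 2 * ‖v‖ ^ 2))
    refine h.congr_deriv ?_
    simp only [InnerProductSpace.toDual_apply_apply, inner_sub_left]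
    push_cast
    ring
  have hanti : AntitoneOn φ (Set.Icc 0 1) := by
    refine antitoneOn_of_deriv_nonpos (convex_Icc 0 1)
      (fun t _ ↦ (hφ t).continuousAt.continuousWithinAt)
      (fun t _ ↦ (hφ t).differentiableAt.differentiableWithinAt) fun t ht ↦ ?_
    rw [interior_Icc] at ht
    rw [(hφ t).deriv, sub_nonpos]
    calc ⟪gradient f (y + t • v) - gradient f y, v⟫
        ≤ ‖gradient f (y + t • v) - gradient f y‖ * ‖v‖ := real_inner_le_norm _ _
      _ ≤ L * ‖y + t • v - y‖ * ‖v‖ := by gcongr; exact hsmooth _ _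
      _ = t * (L * ‖v‖ ^ 2) := by
        rw [add_sub_cancel_left, norm_smul, Real.norm_of_nonneg ht.1.le]
        ring
  have h := hanti (Set.left_mem_Icc.2 zero_le_one) (Set.right_mem_Icc.2 zero_le_one) zero_le_one
  simp only [φ, one_smul, zero_smul, add_zero] at h
  linarith

/-- Combined supply-rate condition of Lemma 5 for the general accelerated method, with
supply rate `X = X₁ + ρ²X₂ + (1 − ρ²)X₃`. -/
theorem general_accelerated_supply_rate_combined {p : ℕ} (f : EuclideanSpace ℝ (Fin p) → ℝ)
    (L m : ℝ) (hm : 0 < m) (hmL : m ≤ L)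
    (hf : Differentiable ℝ f)
    (hsmooth : ∀ x y, ‖gradient f x - gradient f y‖ ≤ L * ‖x - y‖)
    (hsc : ∀ x y, f x ≥ f y + ⟪gradient f y, x - y⟫ + m / 2 * ‖x - y‖ ^ 2)
    (xs : EuclideanSpace ℝ (Fin p)) (hxs : gradient f xs = 0)
    (α β η δ ρ : ℝ) (hδ : δ = β - η) (hρ0 : 0 ≤ ρ) (hρ1 : ρ ≤ 1)
    (xk xkm1 yk xkp1 d : EuclideanSpace ℝ (Fin p))
    (hy : yk = (1 + η) • xk - η • xkm1)
    (hx : xkp1 = (1 + β) • xk - β • xkm1 - α • gradient f yk)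
    (hd : d = xk - xkm1)
    (Q₁ Q₂ Q₃ : ℝ)
    (hQ1 : Q₁ = 1 / 2 * (-(L * δ ^ 2) * ‖d‖ ^ 2 - 2 * (1 - L * α) * δ * ⟪gradient f yk, d⟫
        + α * (2 - L * α) * ‖gradient f yk‖ ^ 2))
    (hQ2 : Q₂ = 1 / 2 * (m * η ^ 2 * ‖d‖ ^ 2 - 2 * η * ⟪gradient f yk, d⟫))
    (hQ3 : Q₃ = 1 / 2 * (m * ‖yk - xs‖ ^ 2 - 2 * ⟪gradient f yk, yk - xs⟫)) :
    Q₁ + ρ ^ 2 * Q₂ + (1 - ρ ^ 2) * Q₃ ≤ ρ ^ 2 * (f xk - f xs) - (f xkp1 - f xs) := by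
  have h1 := le_add_inner_gradient_add_sq hf hsmooth yk (δ • d - α • gradient f yk)
  have h2 := hsc xk yk
  have h3 := hsc xs yk
  have e1 : yk + (δ • d - α • gradient f yk) = xkp1 := by
    rw [hx, hd, hδ]
    nth_rewrite 1 [hy]
    module
  have e2 : xk - yk = -(η • d) := by
    rw [hy, hd]
    module
  rw [e1, norm_sub_sq_real, inner_sub_right, real_inner_smul_left, real_inner_smul_right,
    real_inner_smul_right, real_inner_smul_right, real_inner_self_eq_norm_sq, norm_smul, norm_smul,
    mul_pow, mul_pow, Real.norm_eq_abs, Real.norm_eq_abs, sq_abs, sq_abs,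
    real_inner_comm (gradient f yk) d] at h1
  rw [e2, inner_neg_right, real_inner_smul_right, norm_neg, norm_smul, mul_pow, Real.norm_eq_abs,
    sq_abs] at h2
  rw [← neg_sub yk xs, inner_neg_right, norm_neg] at h3
  have hQ₁ : Q₁ ≤ f yk - f xkp1 := by
    rw [hQ1]
    linarith
  have hQ₂ : Q₂ ≤ f xk - f yk := by
    rw [hQ2]
    linarith
  have hQ₃ : Q₃ ≤ f xs - f yk := by
    rw [hQ3]
    linarith
  have hρ : 0 ≤ 1 - ρ ^ 2 := sub_nonneg.2 (pow_le_one₀ hρ0 hρ1)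
  calc Q₁ + ρ ^ 2 * Q₂ + (1 - ρ ^ 2) * Q₃
      ≤ (f yk - f xkp1) + ρ ^ 2 * (f xk - f yk) + (1 - ρ ^ 2) * (f xs - f yk) := by gcongr
    _ = ρ ^ 2 * (f xk - f xs) - (f xkp1 - f xs) := by ring
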